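/- arXiv:0910.0633 — 2 statements merged into one kernel-verified Lean document; each statement's English description precedes it below -/
import Mathlib

section
/- Let A be a finite-dimensional K-algebra and let 𝔞 ⊆ A be a subalgebra such that (rad 𝔞)A = rad A. Then for every finite-dimensional left A-module M and every n ≥ 1, the subspace (rad^n A)·M equals the subspace spanned by all elements x_1⋯x_n·m with x_i ∈ rad 𝔞, m ∈ M (i.e. the n-th radical of M as an A-module coincides with its n-th radical as an 𝔞-module). In particular (n = 1), the quotient M/rad M computed over A coincides, upon restriction, with the head of M as an 𝔞-module. -/
/-- The Jacobson radical of a `K`-algebra `A`, viewed as a `K`-submodule of `A`. -/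
def jacobsonRadical (K : Type*) (A : Type*) [Field K] [Ring A] [Algebra K A] :
    Submodule K A :=
  Submodule.restrictScalars K (Ideal.jacobson (⊥ : Ideal A))

/-- The image in `A` of the Jacobson radical of a subalgebra `𝔞 ⊆ A`,
viewed as a `K`-submodule of `A`. -/
def subalgebraRadical {K : Type*} {A : Type*} [Field K] [Ring A] [Algebra K A]
    (𝔞 : Subalgebra K A) : Submodule K A :=
  Submodule.map 𝔞.val.toLinearMap
    (Submodule.restrictScalars K (Ideal.jacobson (⊥ : Ideal 𝔞)))

/-- For a `K`-submodule `p` of `A` and an `A`-module `M`, the `K`-subspace `p • M` of `M`,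
i.e. the `K`-span of all products `x • m` with `x ∈ p` and `m ∈ M`. -/
def smulSpan {K : Type*} {A : Type*} [Field K] [Ring A] [Algebra K A]
    (p : Submodule K A) (M : Type*) [AddCommGroup M] [Module A M] [Module K M]
    [IsScalarTower K A M] : Submodule K M :=
  Submodule.span K {z : M | ∃ x ∈ p, ∃ m : M, x • m = z}

theorem top_mul_jacobsonRadical (K A : Type*) [Field K] [Ring A] [Algebra K A] :
    (⊤ : Submodule K A) * jacobsonRadical K A = jacobsonRadical K A := by
  apply le_antisymm
  · rw [Submodule.mul_le]
    intro a _ x hx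
    exact Ideal.mul_mem_left (Ideal.jacobson (⊥ : Ideal A)) a hx
  · intro x hx
    simpa using Submodule.mul_mem_mul (Submodule.mem_top (R := K) (x := (1 : A))) hx

/-- If `R * ⊤ = J` for a `K`-subspace `J` stable under left multiplication, then
`R ^ n * ⊤ = J ^ n` for every `n ≥ 1`. -/
theorem pow_mul_top_eq_pow_of_mul_top_eq {K A : Type*} [Field K] [Ring A] [Algebra K A]
    {R J : Submodule K A} (hJ : (⊤ : Submodule K A) * J = J)
    (h : R * (⊤ : Submodule K A) = J) {n : ℕ} (hn : 1 ≤ n) :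
    R ^ n * (⊤ : Submodule K A) = J ^ n := by
  induction n, hn using Nat.le_induction with
  | base => simpa using h
  | succ n _ ih => rw [pow_succ, mul_assoc, h, pow_succ, ← ih, mul_assoc, hJ]

theorem smulSpan_mul_top {K A : Type*} [Field K] [Ring A] [Algebra K A]
    (p : Submodule K A) (M : Type*) [AddCommGroup M] [Module A M] [Module K M]
    [IsScalarTower K A M] :
    smulSpan (p * (⊤ : Submodule K A)) M = smulSpan p M := by
  apply le_antisymm <;> refine Submodule.span_le.2 ?_ <;> rintro _ ⟨x, hx, m, rfl⟩
  · induction hx using Submodule.mul_induction_on' with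
    | mem_mul_mem a ha b _ =>
      exact Submodule.subset_span ⟨a, ha, b • m, (mul_smul a b m).symm⟩
    | add x _ y _ hx hy =>
      rw [add_smul]
      exact add_mem hx hy
  · refine Submodule.subset_span ⟨x, ?_, m, rfl⟩
    simpa using Submodule.mul_mem_mul hx (Submodule.mem_top (R := K) (x := (1 : A)))


/-- If `𝔞 ⊆ A` is a subalgebra of a finite-dimensional `K`-algebra `A` with
`(rad 𝔞)A = rad A`, then for every finite-dimensional `A`-module `M` and every `n ≥ 1` the
subspace `(rad^n A)·M` coincides with the subspace spanned by all `x₁⋯xₙ·m` with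
`xᵢ ∈ rad 𝔞`, `m ∈ M`; i.e. the `n`-th radical of `M` over `A` agrees with the one over `𝔞`.
In particular (`n = 1`), the head `M/rad M` over `A` coincides with the head of `M` over `𝔞`. -/
theorem radical_pow_smul_eq_subalgebraRadical_pow_smul
    {K : Type*} [Field K] {A : Type*} [Ring A] [Algebra K A] [FiniteDimensional K A]
    (𝔞 : Subalgebra K A)
    (h : subalgebraRadical 𝔞 * (⊤ : Submodule K A) = jacobsonRadical K A)
    (M : Type*) [AddCommGroup M] [Module A M] [Module K M] [IsScalarTower K A M]
    [FiniteDimensional K M] :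
    ∀ n : ℕ, 1 ≤ n →
      smulSpan ((jacobsonRadical K A) ^ n) M = smulSpan ((subalgebraRadical 𝔞) ^ n) M := by
  intro n hn
  rw [← pow_mul_top_eq_pow_of_mul_top_eq (top_mul_jacobsonRadical K A) h hn, smulSpan_mul_top]
end

section
/- Let A be a finite-dimensional K-algebra and let 𝔞 ⊆ A be a subalgebra such that (rad 𝔞)A = rad A. Then a finite-dimensional A-module L is completely reducible if and only if its restriction to 𝔞 is completely reducible as an 𝔞-module. -/
/-- A module over a semiprimary ring is semisimple if and only if it is annihilated by the
Jacobson radical of the ring. -/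
theorem isSemisimpleModule_iff_jacobson_le_annihilator {R M : Type*} [Ring R]
    [IsSemiprimaryRing R] [AddCommGroup M] [Module R M] :
    IsSemisimpleModule R M ↔ Ring.jacobson R ≤ Module.annihilator R M := by
  refine ⟨fun _ ↦ IsSemisimpleModule.jacobson_le_annihilator R M, fun h ↦ ?_⟩
  rw [← SetLike.coe_subset_coe, ← Module.isTorsionBySet_iff_subset_annihilator] at h
  let _ := h.module
  exact (h.semilinearMap.isSemisimpleModule_iff_of_bijective Function.bijective_id).2
    inferInstance

/-- Let `𝔞 ⊆ A` be a subalgebra of a finite-dimensional `K`-algebra `A` with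
`(rad 𝔞)A = rad A`.  Then a finite-dimensional `A`-module `L` is completely reducible
(semisimple) if and only if its restriction to `𝔞` is completely reducible. -/
theorem isSemisimpleModule_iff_of_radical_eq
    {K : Type*} [Field K] {A : Type*} [Ring A] [Algebra K A] [FiniteDimensional K A]
    (𝔞 : Subalgebra K A)
    (h : subalgebraRadical 𝔞 * (⊤ : Submodule K A) = jacobsonRadical K A)
    (L : Type*) [AddCommGroup L] [Module A L] [Module K L] [IsScalarTower K A L]
    [FiniteDimensional K L] :
    IsSemisimpleModule A L ↔ IsSemisimpleModule 𝔞 L := by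
  have : IsArtinianRing A := .of_finite K A
  have : IsArtinianRing 𝔞 := .of_finite K 𝔞
  rw [isSemisimpleModule_iff_jacobson_le_annihilator,
    isSemisimpleModule_iff_jacobson_le_annihilator]
  simp only [SetLike.le_def, Module.mem_annihilator]
  constructor
  · intro hA x hx m
    refine hA (x := (x : A)) ?_ m
    have hmem : (x : A) * 1 ∈ jacobsonRadical K A :=
      h ▸ Submodule.mul_mem_mul (Submodule.mem_map_of_mem (by simpa [Ideal.jacobson_bot] using hx))
        Submodule.mem_top
    simpa [jacobsonRadical, Ideal.jacobson_bot] using hmem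
  · intro ha x hx m
    have hmem : x ∈ subalgebraRadical 𝔞 * (⊤ : Submodule K A) := by
      rw [h]
      simpa [jacobsonRadical, Ideal.jacobson_bot] using hx
    clear hx
    induction hmem using Submodule.mul_induction_on' with
    | mem_mul_mem y hy b _ =>
      obtain ⟨z, hz, rfl⟩ := hy
      rw [mul_smul]
      exact ha (by simpa [Ideal.jacobson_bot] using hz) (b • m)
    | add y _ z _ hy hz => rw [add_smul, hy, hz, add_zero]
end
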